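/- Let S be a finite planar point set in general position whose convex hull is a triangle (exactly 3 points of S are vertices of the convex hull) and which has at least 5 points of S in the interior of its convex hull. Then some 7 points of S form a 7-pseudo-triangle (not necessarily empty in S). -/

import Mathlib

open Set

noncomputable section

/-- Points of the plane. -/
abbrev Pt : Type := ℝ × ℝ

/-- Two-dimensional cross product. -/
def cross2 (u w : Pt) : ℝ := u.1 * w.2 - u.2 * w.1

/-- A set of points is in general position if no three of its points are collinear. -/
def GenPos (S : Set Pt) : Prop :=
  ∀ p ∈ S, ∀ q ∈ S, ∀ r ∈ S, p ≠ q → p ≠ r → q ≠ r →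
    ¬ Collinear ℝ ({p, q, r} : Set Pt)

/-- `v : ZMod n → Pt` lists the vertices (in cyclic order) of a simple polygon:
vertices are pairwise distinct, non-adjacent edges are disjoint, and adjacent
edges meet exactly in their common vertex. -/
structure IsSimplePolygon (n : ℕ) (v : ZMod n → Pt) : Prop where
  three_le : 3 ≤ n
  inj : Function.Injective v
  nonadj : ∀ i j : ZMod n, i ≠ j → i ≠ j + 1 → j ≠ i + 1 →
    segment ℝ (v i) (v (i + 1)) ∩ segment ℝ (v j) (v (j + 1)) = ∅
  adj : ∀ i : ZMod n,
    segment ℝ (v i) (v (i + 1)) ∩ segment ℝ (v (i + 1)) (v (i + 2)) = {v (i + 1)}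

/-- Twice the signed area of a polygon. -/
def signedArea (n : ℕ) (v : ZMod n → Pt) : ℝ :=
  if h : n = 0 then 0 else
    haveI : NeZero n := ⟨h⟩
    ∑ i : ZMod n, cross2 (v i) (v (i + 1))

/-- The turning cross product at vertex `i`. -/
def vtxCross (n : ℕ) (v : ZMod n → Pt) (i : ZMod n) : ℝ :=
  cross2 (v i - v (i - 1)) (v (i + 1) - v i)

/-- Vertex `i` of a simple polygon is convex (interior angle `< π`) iff the turn
at `i` has the same (strict) sign as the orientation of the polygon. -/
def IsConvexVtx (n : ℕ) (v : ZMod n → Pt) (i : ZMod n) : Prop :=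
  0 < vtxCross n v i * signedArea n v

/-- A pseudo-triangle: a simple polygon in which every vertex is strictly convex or
strictly reflex, with exactly three convex vertices. -/
def IsPseudoTriangle (n : ℕ) (v : ZMod n → Pt) : Prop :=
  IsSimplePolygon n v ∧ (∀ i : ZMod n, vtxCross n v i ≠ 0) ∧
    {i : ZMod n | IsConvexVtx n v i}.ncard = 3

/-- A standard pseudo-triangle: each of the three side chains has at least two
edges, i.e. no two convex vertices are cyclically adjacent. -/
def IsStandardPseudoTriangle (n : ℕ) (v : ZMod n → Pt) : Prop :=
  IsPseudoTriangle n v ∧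
    ∀ i : ZMod n, IsConvexVtx n v i → ¬ IsConvexVtx n v (i + 1)

/-- A mountain: a pseudo-triangle in which exactly one side chain consists of a
single edge (i.e. exactly one cyclically adjacent pair of convex vertices);
a 3-mountain is a triangle. -/
def IsMountain (n : ℕ) (v : ZMod n → Pt) : Prop :=
  IsPseudoTriangle n v ∧
    (n = 3 ∨ {i : ZMod n | IsConvexVtx n v i ∧ IsConvexVtx n v (i + 1)}.ncard = 1)

/-- The boundary of a polygon: the union of its edges. -/
def polyBoundary (n : ℕ) (v : ZMod n → Pt) : Set Pt :=
  ⋃ i : ZMod n, segment ℝ (v i) (v (i + 1))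

/-- The interior of a simple polygon: the union of the bounded connected
components of the complement of its boundary. -/
def polyInterior (n : ℕ) (v : ZMod n → Pt) : Set Pt :=
  {x : Pt | x ∉ polyBoundary n v ∧
    Bornology.IsBounded (connectedComponentIn (polyBoundary n v)ᶜ x)}

/-- A polygon is empty in `S` if its interior contains no point of `S`. -/
def EmptyIn (n : ℕ) (v : ZMod n → Pt) (S : Set Pt) : Prop :=
  polyInterior n v ∩ S = ∅

/-- `S` contains an empty `ℓ`-pseudo-triangle. -/
def HasEmptyPseudoTriangle (ℓ : ℕ) (S : Set Pt) : Prop :=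
  ∃ v : ZMod ℓ → Pt, Set.range v ⊆ S ∧ IsPseudoTriangle ℓ v ∧ EmptyIn ℓ v S

/-- A set of points is in convex position if each of them is a vertex of their
convex hull. -/
def ConvexPos (H : Set Pt) : Prop := ∀ p ∈ H, p ∉ convexHull ℝ (H \ {p})

/-- `H` is a `k`-hole in `S`: `k` points of `S` in convex position whose convex
hull contains no other point of `S` in its interior. -/
def IsHole (k : ℕ) (S H : Set Pt) : Prop :=
  H ⊆ S ∧ H.ncard = k ∧ ConvexPos H ∧
    ∀ p ∈ S, p ∈ interior (convexHull ℝ H) → p ∈ H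

/-- `S` contains a `k`-hole. -/
def HasHole (k : ℕ) (S : Set Pt) : Prop := ∃ H : Set Pt, IsHole k S H

/-- The points of `S` that are vertices of the convex hull of `S`. -/
def hullVertices (S : Set Pt) : Set Pt := {p ∈ S | p ∉ convexHull ℝ (S \ {p})}

/-- The points of `S` lying in the interior of the convex hull of `S`. -/
def interiorPts (S : Set Pt) : Set Pt := {p ∈ S | p ∈ interior (convexHull ℝ S)}

/-- `S` is `λ`-convex: every triangle with vertices in `S` contains at most `λ`
points of `S` in its interior. -/
def LambdaConvex (lam : ℕ) (S : Set Pt) : Prop :=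
  ∀ p ∈ S, ∀ q ∈ S, ∀ r ∈ S,
    (S ∩ interior (convexHull ℝ ({p, q, r} : Set Pt))).ncard ≤ lam


/-! ### Orientation determinant -/

/-- Orientation determinant of three points. -/
def D (p q r : Pt) : ℝ := cross2 (q - p) (r - p)

theorem D_eq (p q r : Pt) :
    D p q r = (q.1 - p.1) * (r.2 - p.2) - (q.2 - p.2) * (r.1 - p.1) := by
  simp [D, cross2]

theorem D_rot (p q r : Pt) : D p q r = D q r p := by
  simp only [D_eq]; ring

theorem D_swap (p q r : Pt) : D p q r = - D p r q := by
  simp only [D_eq]; ring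

theorem D_self₁ (p r : Pt) : D p p r = 0 := by simp only [D_eq]; ring
theorem D_self₂ (p r : Pt) : D p r p = 0 := by simp only [D_eq]; ring
theorem D_self₃ (p r : Pt) : D p r r = 0 := by simp only [D_eq]; ring

theorem D_comb (u v a b : Pt) (s t : ℝ) (h : s + t = 1) :
    D u v (s • a + t • b) = s * D u v a + t * D u v b := by
  obtain rfl : t = 1 - s := by linarith
  simp only [D_eq, Prod.fst_add, Prod.snd_add, Prod.smul_fst, Prod.smul_snd, smul_eq_mul]
  ring

theorem sep1 (u v a b c d : Pt) (ha : 0 ≤ D u v a) (hb : 0 ≤ D u v b)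
    (hc : D u v c < 0) (hd : D u v d < 0) : segment ℝ a b ∩ segment ℝ c d = ∅ := by
  rw [Set.eq_empty_iff_forall_notMem]
  rintro x ⟨⟨s, t, hs, ht, hst, rfl⟩, s', t', hs', ht', hst', h⟩
  have h1 := D_comb u v a b s t hst
  have h2 := D_comb u v c d s' t' hst'
  rw [h, h1] at h2
  have : 0 ≤ s * D u v a + t * D u v b := by positivity
  have : s' * D u v c + t' * D u v d < 0 := by
    rcases hs'.eq_or_lt with h0 | h0
    · have : t' = 1 := by linarith
      subst this; rw [← h0]; linarith
    · nlinarith [mul_pos_of_neg_of_neg hc (neg_lt_zero.2 h0), mul_nonneg ht' (neg_nonneg.2 hd.le)]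
  linarith

theorem sep1' (u v a b c d : Pt) (ha : D u v a ≤ 0) (hb : D u v b ≤ 0)
    (hc : 0 < D u v c) (hd : 0 < D u v d) : segment ℝ a b ∩ segment ℝ c d = ∅ := by
  have key : ∀ w, D v u w = - D u v w := fun w => by simp only [D_eq]; ring
  apply sep1 v u <;> rw [key] <;> linarith

theorem seg_zero (u v a b x : Pt) (ha : 0 < D u v a) (hb : D u v b = 0)
    (hx : x ∈ segment ℝ a b) : 0 ≤ D u v x ∧ (D u v x = 0 → x = b) := by
  obtain ⟨s, t, hs, ht, hst, rfl⟩ := hx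
  rw [D_comb u v a b s t hst, hb]
  refine ⟨by simp; positivity, fun h => ?_⟩
  have : s = 0 := by
    simp at h; exact h.resolve_right ha.ne'
  subst this
  have : t = 1 := by linarith
  subst this; simp

theorem seg_zero' (u v a b x : Pt) (ha : D u v a < 0) (hb : D u v b = 0)
    (hx : x ∈ segment ℝ a b) : D u v x ≤ 0 ∧ (D u v x = 0 → x = b) := by
  have key : ∀ w, D v u w = - D u v w := fun w => by simp only [D_eq]; ring
  obtain ⟨h1, h2⟩ := seg_zero v u a b x (by rw [key]; linarith) (by rw [key]; linarith) hx
  rw [key] at h1 h2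
  exact ⟨by linarith, fun h => h2 (by linarith)⟩

theorem sep2 (u v a b c d : Pt) (ha : 0 < D u v a) (hb : D u v b = 0)
    (hc : D u v c < 0) (hd : D u v d = 0) (hbd : b ≠ d) :
    segment ℝ a b ∩ segment ℝ c d = ∅ := by
  rw [Set.eq_empty_iff_forall_notMem]
  rintro x ⟨h1, h2⟩
  obtain ⟨p1, p2⟩ := seg_zero u v a b x ha hb h1
  obtain ⟨q1, q2⟩ := seg_zero' u v c d x hc hd h2
  have h0 : D u v x = 0 := le_antisymm q1 p1
  exact hbd ((p2 h0).symm.trans (q2 h0))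

theorem adj_seg (x y z : Pt) (h : D x y z ≠ 0) :
    segment ℝ x y ∩ segment ℝ y z = {y} := by
  ext w
  simp only [Set.mem_inter_iff, Set.mem_singleton_iff]
  constructor
  · rintro ⟨h1, h2⟩
    have hx : D x y w = 0 := by
      obtain ⟨s, t, hs, ht, hst, rfl⟩ := h1
      rw [D_comb _ _ _ _ _ _ hst, D_self₂, D_self₃]; simp
    rw [segment_symm] at h2
    rcases lt_or_gt_of_ne h with h | h
    · exact (seg_zero' x y z y w h (D_self₃ _ _) h2).2 hx
    · exact (seg_zero x y z y w h (D_self₃ _ _) h2).2 hx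
  · rintro rfl
    exact ⟨right_mem_segment _ _ _, left_mem_segment _ _ _⟩

/-! ### Positivity of the area -/

theorem area_aux (T al ga pa pb pc qa qb qc : ℝ) (hal : 0 < al) (hga : 0 < ga)
    (hqa : 0 < qa) (hqc : 0 < qc)
    (hp : pa + pb + pc = T) (hq : qa + qb + qc = T)
    (h1 : pc < al * pb) (h4 : qa < ga * qb) (h3 : qa * pc < qc * pa) :
    (pc + qa) * (1 + al + ga) < T * (al + ga) := by
  have I : pc * (qc * (1 + al) + al * qa) < al * T * qc := by
    obtain rfl : pb = T - pa - pc := by linarith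
    nlinarith [mul_lt_mul_of_pos_right h1 hqc, mul_lt_mul_of_pos_left h3 hal]
  have II : qc * ga < ga * T - qa * (1 + ga) := by
    obtain rfl : qb = T - qa - qc := by linarith
    nlinarith
  have III : qa * (1 + al + ga) < T * (al + ga) := by
    have h5 : qa * (1 + ga) < ga * T := by nlinarith [mul_pos hqc hga]
    have h6 : qa < T := by nlinarith
    nlinarith
  set W := T * (al + ga) - qa * (1 + al + ga) with hW
  have hWp : 0 < W := by linarith
  have hden : 0 < qc * (1 + al) + al * qa := by positivity
  have IV : al * T * qc * (1 + al + ga) ≤ W * (qc * (1 + al) + al * qa) := by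
    have e : W * (qc * (1 + al) + al * qa) - al * T * qc * (1 + al + ga)
        = qc * (T * ga - (1 + al) * (1 + al + ga) * qa) + al * qa * W := by
      rw [hW]; ring
    rcases le_or_gt 0 (T * ga - (1 + al) * (1 + al + ga) * qa) with h | h
    · have : 0 ≤ qc * (T * ga - (1 + al) * (1 + al + ga) * qa) + al * qa * W := by positivity
      linarith
    · have h7 := mul_lt_mul_of_neg_right II h
      have e2 : (ga * T - qa * (1 + ga)) * (T * ga - (1 + al) * (1 + al + ga) * qa)
          + ga * (al * qa * W) = (ga * T - (1 + al + ga) * qa) ^ 2 := by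
        rw [hW]; ring
      have h8 := sq_nonneg (ga * T - (1 + al + ga) * qa)
      have h9 : 0 ≤ ga * (qc * (T * ga - (1 + al) * (1 + al + ga) * qa) + al * qa * W) := by
        nlinarith
      have := nonneg_of_mul_nonneg_right h9 hga
      linarith
  have V : pc * (1 + al + ga) < W := by
    have : (pc * (1 + al + ga)) * (qc * (1 + al) + al * qa)
        < W * (qc * (1 + al) + al * qa) := by
      have := mul_lt_mul_of_pos_right I (show 0 < 1 + al + ga by positivity)
      nlinarith
    exact lt_of_mul_lt_mul_right this hden.le
  rw [hW] at V
  linarith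

theorem area_real (T pa pb pc qa qb qc ra rb rc sa sb sc : ℝ) (hT : 0 < T)
    (hqa : 0 < qa) (hqc : 0 < qc)
    (hra : 0 < ra) (hrb : 0 < rb) (hsb : 0 < sb) (hsc : 0 < sc)
    (hp : pa + pb + pc = T) (hq : qa + qb + qc = T) (hr : ra + rb + rc = T)
    (hs : sa + sb + sc = T)
    (h1 : pc * sb < pb * sc) (h2 : sc * rb < sb * rc) (h3 : qa * pc < qc * pa)
    (h4 : rb * qa < ra * qb) (h5 : sb * ra < sa * rb) :
    T * (pc + qa + sb) + (sa * rb - sb * ra) < T ^ 2 := by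
  have h := area_aux T (sc / sb) (ra / rb) pa pb pc qa qb qc (by positivity) (by positivity)
    hqa hqc hp hq
    (by rw [div_mul_eq_mul_div, lt_div_iff₀ hsb]; linarith)
    (by rw [div_mul_eq_mul_div, lt_div_iff₀ hrb]; linarith) h3
  have hK : 0 < sb * rb + sc * rb + ra * sb := by positivity
  have h' : (pc + qa) * (sb * rb + sc * rb + ra * sb) < T * (sc * rb + ra * sb) := by
    have := mul_lt_mul_of_pos_right h (mul_pos hsb hrb)
    have e1 : (pc + qa) * (1 + sc / sb + ra / rb) * (sb * rb)
        = (pc + qa) * (sb * rb + sc * rb + ra * sb) := by field_simp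
    have e2 : T * (sc / sb + ra / rb) * (sb * rb) = T * (sc * rb + ra * sb) := by field_simp
    rwa [e1, e2] at this
  have hi : (sb * rb + sc * rb + ra * sb) * (T * sb + (sa * rb - sb * ra))
      ≤ T ^ 2 * (sb * rb) := by
    have := mul_pos (sub_pos.2 h2) (sub_pos.2 h5)
    obtain rfl : rc = T - ra - rb := by linarith
    obtain rfl : sa = T - sb - sc := by linarith
    nlinarith
  have : (sb * rb + sc * rb + ra * sb) * (T * (pc + qa + sb) + (sa * rb - sb * ra))
      < (sb * rb + sc * rb + ra * sb) * T ^ 2 := by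
    have := mul_lt_mul_of_pos_left h' hT
    nlinarith
  exact lt_of_mul_lt_mul_left this hK.le

/-! ### The pseudo-triangle template -/

/-- The point lies strictly inside the (positively oriented) triangle. -/
def Ins (A B C x : Pt) : Prop := 0 < D B C x ∧ 0 < D C A x ∧ 0 < D A B x

theorem D_sum (A B C x : Pt) : D B C x + D C A x + D A B x = D A B C := by
  simp only [D_eq]; ring

theorem D_bary (A B C x y : Pt) :
    D A x y * D A B C = D C A x * D A B y - D A B x * D C A y := by
  simp only [D_eq]; ring

theorem D_trans (A B C x y z : Pt) (hx : Ins A B C x) (hy : Ins A B C y) (hz : Ins A B C z)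
    (h1 : 0 < D A x y) (h2 : 0 < D A y z) : 0 < D A x z := by
  have e : D A B y * D A x z = D A B x * D A y z + D A B z * D A x y := by
    simp only [D_eq]; ring
  have : 0 < D A B y * D A x z := by
    rw [e]; have := hx.2.2; have := hz.2.2; positivity
  exact pos_of_mul_pos_right this hy.2.2.le

theorem template (A B C p q r s : Pt) (hT : 0 < D A B C)
    (hp : Ins A B C p) (hq : Ins A B C q) (hr : Ins A B C r) (hs : Ins A B C s)
    (h1 : 0 < D A p s) (h2 : 0 < D A s r) (h3 : 0 < D B q p) (h4 : 0 < D C r q)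
    (h5 : 0 < D C s r) :
    IsPseudoTriangle 7 (![A, p, B, q, C, r, s] : Fin 7 → Pt) := by
  have hApr : 0 < D A p r := D_trans A B C p s r hp hs hr h1 h2
  have rotI : ∀ x, Ins A B C x → Ins C A B x := fun x h => ⟨h.2.2, h.1, h.2.1⟩
  have hCsq : 0 < D C s q :=
    D_trans C A B s r q (rotI _ hs) (rotI _ hr) (rotI _ hq) h5 h4
  obtain ⟨pa, pb, pc⟩ := hp
  obtain ⟨qa, qb, qc⟩ := hq
  obtain ⟨ra, rb, rc⟩ := hr
  obtain ⟨sa, sb, sc⟩ := hs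
  -- auxiliary signs
  have hApB : D A p B < 0 := by rw [D_swap]; linarith
  have hApC : 0 < D A p C := by rw [D_rot, D_rot]; exact pb
  have hBpA : 0 < D B p A := by rw [D_rot, D_rot]; exact pc
  have hBpC : D B p C < 0 := by rw [D_swap]; linarith
  have hBpq : D B p q < 0 := by rw [D_swap]; linarith
  have hCqB : 0 < D C q B := by rw [D_rot, D_rot]; exact qa
  have hCqA : D C q A < 0 := by rw [D_swap]; linarith
  have hCqr : D C q r < 0 := by rw [D_swap]; linarith
  have hCqs : D C q s < 0 := by rw [D_swap]; linarith
  have hCsA : D C s A < 0 := by rw [D_swap]; linarith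
  have hpB : p ≠ B := by rintro rfl; rw [D_self₃] at pc; exact pc.false
  have hpA : p ≠ A := by rintro rfl; rw [D_self₂] at pc; exact pc.false
  have hqC : q ≠ C := by rintro rfl; rw [D_self₃] at qa; exact qa.false
  have hCs : C ≠ s := by rintro rfl; rw [D_self₃] at sa; exact sa.false
  -- turning signs
  have tA : 0 < D s A p := by rw [D_rot]; exact h1
  have tp : D A p B < 0 := hApB
  have tB : 0 < D p B q := by rw [D_rot]; exact h3
  have tq : D B q C < 0 := by rw [D_swap]; linarith
  have tC : 0 < D q C r := by rw [D_rot]; exact h4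
  have tr : D C r s < 0 := by rw [D_swap]; linarith
  have ts : D r s A < 0 := by rw [D_rot, D_rot, D_swap]; linarith
  -- separations
  have s13 : segment ℝ A p ∩ segment ℝ B q = ∅ := by
    rw [segment_symm ℝ B q]
    exact sep2 B p A p q B hBpA (D_self₃ _ _) hBpq (D_self₂ _ _) hpB
  have s14 : segment ℝ A p ∩ segment ℝ q C = ∅ :=
    sep1 B p A p q C hBpA.le (D_self₃ _ _).ge hBpq hBpC
  have s15 : segment ℝ A p ∩ segment ℝ C r = ∅ :=
    sep1' A p A p C r (D_self₂ _ _).le (D_self₃ _ _).le hApC hApr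
  have s16 : segment ℝ A p ∩ segment ℝ r s = ∅ :=
    sep1' A p A p r s (D_self₂ _ _).le (D_self₃ _ _).le hApr h1
  have s24 : segment ℝ p B ∩ segment ℝ q C = ∅ :=
    sep1 B p p B q C (D_self₃ _ _).ge (D_self₂ _ _).ge hBpq hBpC
  have s25 : segment ℝ p B ∩ segment ℝ C r = ∅ :=
    sep1' A p p B C r (D_self₃ _ _).le hApB.le hApC hApr
  have s26 : segment ℝ p B ∩ segment ℝ r s = ∅ :=
    sep1' A p p B r s (D_self₃ _ _).le hApB.le hApr h1
  have s27 : segment ℝ p B ∩ segment ℝ s A = ∅ := by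
    rw [Set.inter_comm, segment_symm ℝ p B]
    exact sep2 A p s A B p h1 (D_self₂ _ _) hApB (D_self₃ _ _) hpA.symm
  have s35 : segment ℝ B q ∩ segment ℝ C r = ∅ := by
    rw [segment_symm ℝ C r]
    exact sep2 C q B q r C hCqB (D_self₃ _ _) hCqr (D_self₂ _ _) hqC
  have s36 : segment ℝ B q ∩ segment ℝ r s = ∅ :=
    sep1 C q B q r s hCqB.le (D_self₃ _ _).ge hCqr hCqs
  have s37 : segment ℝ B q ∩ segment ℝ s A = ∅ :=
    sep1 C q B q s A hCqB.le (D_self₃ _ _).ge hCqs hCqA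
  have s46 : segment ℝ q C ∩ segment ℝ r s = ∅ :=
    sep1 C q q C r s (D_self₃ _ _).ge (D_self₂ _ _).ge hCqr hCqs
  have s47 : segment ℝ q C ∩ segment ℝ s A = ∅ :=
    sep1 C q q C s A (D_self₃ _ _).ge (D_self₂ _ _).ge hCqs hCqA
  have s57 : segment ℝ C r ∩ segment ℝ s A = ∅ := by
    rw [segment_symm ℝ C r, segment_symm ℝ s A]
    exact sep2 C s r C A s h5 (D_self₂ _ _) hCsA (D_self₃ _ _) hCs
  -- area
  have area : 0 < cross2 A p + cross2 p B + cross2 B q + cross2 q C + cross2 C r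
      + cross2 r s + cross2 s A := by
    have hB : D B q p * D A B C = D A B q * D B C p - D B C q * D A B p := by
      simp only [D_eq]; ring
    have hC : ∀ x y, D C x y * D A B C = D B C x * D C A y - D C A x * D B C y := by
      intro x y; simp only [D_eq]; ring
    have k1 := mul_pos h1 hT
    have k2 := mul_pos h2 hT
    have k3 := mul_pos h3 hT
    have k4 := mul_pos h4 hT
    have k5 := mul_pos h5 hT
    rw [D_bary] at k1 k2
    rw [hB] at k3
    rw [hC] at k4 k5
    have key := area_real (D A B C) (D B C p) (D C A p) (D A B p) (D B C q) (D C A q) (D A B q)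
      (D B C r) (D C A r) (D A B r) (D B C s) (D C A s) (D A B s) hT qa qc ra rb sb sc
      (D_sum _ _ _ _) (D_sum _ _ _ _) (D_sum _ _ _ _) (D_sum _ _ _ _)
      (by linarith) (by linarith) (by linarith) (by linarith) (by linarith)
    have e5 := hC s r
    have e : D A B C * (cross2 A p + cross2 p B + cross2 B q + cross2 q C + cross2 C r
      + cross2 r s + cross2 s A) = D A B C ^ 2 - (D A B C * (D A B p + D B C q + D C A s)
        + D C s r * D A B C) := by
      simp only [D_eq, cross2]; ring
    rw [e5] at e
    have : 0 < D A B C * (cross2 A p + cross2 p B + cross2 B q + cross2 q C + cross2 C r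
      + cross2 r s + cross2 s A) := by rw [e]; linarith
    exact pos_of_mul_pos_right this hT.le
  set v : ZMod 7 → Pt := (![A, p, B, q, C, r, s] : Fin 7 → Pt) with hvdef
  have all7 : ∀ P : ZMod 7 → Prop, P 0 → P 1 → P 2 → P 3 → P 4 → P 5 → P 6 → ∀ i, P i := by
    intro P p0 p1 p2 p3 p4 p5 p6 i
    change Fin 7 at i
    fin_cases i <;> assumption
  have hsa : signedArea 7 v = cross2 A p + cross2 p B
      + cross2 B q + cross2 q C + cross2 C r + cross2 r s + cross2 s A := by
    have : signedArea 7 v = ∑ i : Fin 7, cross2 (v i) (v (i + 1 : Fin 7)) := by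
      simp only [signedArea]; rfl
    rw [this, Fin.sum_univ_seven]
    rfl
  have vc : ∀ i : ZMod 7, vtxCross 7 v i = D (v (i - 1)) (v i) (v (i + 1)) := by
    intro i; simp only [vtxCross, D_eq, cross2, Prod.fst_sub, Prod.snd_sub]; ring
  have w0 : vtxCross 7 v 0 = D s A p := vc 0
  have w1 : vtxCross 7 v 1 = D A p B := vc 1
  have w2 : vtxCross 7 v 2 = D p B q := vc 2
  have w3 : vtxCross 7 v 3 = D B q C := vc 3
  have w4 : vtxCross 7 v 4 = D q C r := vc 4
  have w5 : vtxCross 7 v 5 = D C r s := vc 5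
  have w6 : vtxCross 7 v 6 = D r s A := vc 6
  have hA : 0 < signedArea 7 v := by rw [hsa]; exact area
  have nonadj : ∀ i j : ZMod 7, i ≠ j → i ≠ j + 1 → j ≠ i + 1 →
      segment ℝ (v i) (v (i + 1)) ∩ segment ℝ (v j) (v (j + 1)) = ∅ := by
    have half : ∀ i j : Fin 7, i < j → i ≠ j + 1 → j ≠ i + 1 →
        segment ℝ (v i) (v (i + 1 : Fin 7)) ∩ segment ℝ (v j) (v (j + 1 : Fin 7)) = ∅ := by
      intro i j hij h h'
      fin_cases i <;> fin_cases j <;>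
        first
        | exact absurd hij (by decide)
        | exact absurd rfl h
        | exact absurd rfl h'
        | assumption
    intro i j hij h h'
    rcases @lt_or_gt_of_ne (Fin 7) _ i j hij with hl | hl
    · exact half i j hl h h'
    · rw [Set.inter_comm]; exact half j i hl h' h
  have adj : ∀ i : ZMod 7,
      segment ℝ (v i) (v (i + 1)) ∩ segment ℝ (v (i + 1)) (v (i + 2)) = {v (i + 1)} := by
    apply all7
    · exact adj_seg A p B tp.ne
    · exact adj_seg p B q tB.ne'
    · exact adj_seg B q C tq.ne
    · exact adj_seg q C r tC.ne'
    · exact adj_seg C r s tr.ne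
    · exact adj_seg r s A ts.ne
    · exact adj_seg s A p tA.ne'
  have hne0 : ∀ i : ZMod 7, vtxCross 7 v i ≠ 0 := by
    apply all7
    · rw [w0]; exact tA.ne'
    · rw [w1]; exact tp.ne
    · rw [w2]; exact tB.ne'
    · rw [w3]; exact tq.ne
    · rw [w4]; exact tC.ne'
    · rw [w5]; exact tr.ne
    · rw [w6]; exact ts.ne
  have inj : Function.Injective v := by
    intro i j hij
    by_contra hne
    have step : ∀ k : ZMod 7, v k ≠ v (k + 1) := by
      intro k h
      have ht : vtxCross 7 v k ≠ 0 := hne0 k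
      rw [vc, ← h, D_self₃] at ht
      exact ht rfl
    by_cases c1 : i = j + 1
    · exact step j (by rw [← c1, hij])
    · by_cases c2 : j = i + 1
      · exact step i (by rw [← c2, hij])
      · have := nonadj i j hne c1 c2
        have h2 : v i ∈ (∅ : Set Pt) := by
          rw [← this]
          exact ⟨left_mem_segment _ _ _, hij ▸ left_mem_segment _ _ _⟩
        exact h2
  refine ⟨⟨by norm_num, inj, nonadj, adj⟩, hne0, ?_⟩
  · have : {i : ZMod 7 | IsConvexVtx 7 v i} = (({0, 2, 4} : Finset (ZMod 7)) : Set (ZMod 7)) := by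
      ext i
      simp only [Set.mem_ofPred_eq, IsConvexVtx, mul_pos_iff_of_pos_right hA, Finset.mem_coe]
      revert i
      apply all7
      · rw [w0]; exact iff_of_true tA (by decide)
      · rw [w1]; exact iff_of_false tp.not_gt (by decide)
      · rw [w2]; exact iff_of_true tB (by decide)
      · rw [w3]; exact iff_of_false tq.not_gt (by decide)
      · rw [w4]; exact iff_of_true tC (by decide)
      · rw [w5]; exact iff_of_false tr.not_gt (by decide)
      · rw [w6]; exact iff_of_false ts.not_gt (by decide)
    rw [this, Set.ncard_coe_finset]
    decide

def lk5 (b0 b1 b2 b3 b4 : ℕ) : ℕ → ℕ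
  | 0 => b0 | 1 => b1 | 2 => b2 | 3 => b3 | _ => b4

def cmpat (b c b' c' : ℕ) : Bool :=
  bif Nat.beq c c' then false else bif Nat.ble b b' then Nat.ble c' c else true

def L5 : List ℕ := [0, 1, 2, 3, 4]

/-- The pattern of four points in three linear orders. -/
def patB (f g h : ℕ → ℕ) : Bool :=
  L5.any fun s => L5.any fun r => (Nat.blt (f s) (f r) && Nat.blt (h s) (h r)) &&
    L5.any fun p => Nat.blt (f p) (f s) &&
      L5.any fun q => Nat.blt (h r) (h q) && Nat.blt (g q) (g p)

def finB (g h : ℕ → ℕ) : Bool :=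
  patB (fun x => x) g h || (patB g h (fun x => x) || patB h (fun x => x) g)

def srch : Bool :=
  L5.all fun b0 => L5.all fun b1 => Nat.beq b0 b1 || L5.all fun b2 =>
    (Nat.beq b0 b2 || Nat.beq b1 b2) || L5.all fun b3 =>
    (Nat.beq b0 b3 || (Nat.beq b1 b3 || Nat.beq b2 b3)) || L5.all fun b4 =>
    (Nat.beq b0 b4 || (Nat.beq b1 b4 || (Nat.beq b2 b4 || Nat.beq b3 b4))) ||
    L5.all fun c0 => L5.all fun c1 =>
    !(cmpat b0 c0 b1 c1) || L5.all fun c2 =>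
    !(cmpat b0 c0 b2 c2 && cmpat b1 c1 b2 c2) || L5.all fun c3 =>
    !(cmpat b0 c0 b3 c3 && (cmpat b1 c1 b3 c3 && cmpat b2 c2 b3 c3)) || L5.all fun c4 =>
    !(cmpat b0 c0 b4 c4 && (cmpat b1 c1 b4 c4 && (cmpat b2 c2 b4 c4 && cmpat b3 c3 b4 c4))) ||
    finB (lk5 b0 b1 b2 b3 b4) (lk5 c0 c1 c2 c3 c4)
theorem srch_true : srch = true := by decide +kernel

theorem cmpat_true {b c b' c' : ℕ} (hc : c ≠ c') (h : b < b' → c' < c) (hb : b ≠ b') :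
    cmpat b c b' c' = true := by
  have h1 : Nat.beq c c' = false := by
    rw [← Bool.not_eq_true, Nat.beq_eq]; exact hc
  unfold cmpat
  rw [h1, cond_false]
  by_cases hle : b ≤ b'
  · rw [Nat.ble_eq_true_of_le hle, cond_true]
    exact Nat.ble_eq_true_of_le (h (lt_of_le_of_ne hle hb)).le
  · have : Nat.ble b b' = false := by
      rw [← Bool.not_eq_true, Nat.ble_eq]; exact hle
    rw [this, cond_false]

theorem mem_L5 {n : ℕ} : n ∈ L5 ↔ n < 5 := by
  simp only [L5, List.mem_cons, List.not_mem_nil, or_false]; omega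

/-- The pattern of four points in three linear orders. -/
def Pat {α : Type} [LT α] (f g h : ℕ → α) (p q r s : ℕ) : Prop :=
  f p < f s ∧ f s < f r ∧ h s < h r ∧ h r < h q ∧ g q < g p

theorem patB_true {f g h : ℕ → ℕ} (H : patB f g h = true) :
    ∃ p q r s, p < 5 ∧ q < 5 ∧ r < 5 ∧ s < 5 ∧ Pat f g h p q r s := by
  simp only [patB, List.any_eq_true, Bool.and_eq_true, mem_L5, Nat.blt_eq] at H
  obtain ⟨s, hs, r, hr, ⟨h1, h2⟩, p, hp, h3, q, hq, h4, h5⟩ := H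
  exact ⟨p, q, r, s, hp, hq, hr, hs, h3, h1, h2, h4, h5⟩

theorem lk5_eq (b : ℕ → ℕ) {n : ℕ} (hn : n < 5) : lk5 (b 0) (b 1) (b 2) (b 3) (b 4) n = b n := by
  interval_cases n <;> rfl

theorem beqF {a b : ℕ} (h : a ≠ b) : Nat.beq a b = false := by
  rw [← Bool.not_eq_true, Nat.beq_eq]; exact h

theorem comb_nat (b c : ℕ → ℕ) (hb5 : ∀ i < 5, b i < 5) (hc5 : ∀ i < 5, c i < 5)
    (hb : ∀ i j, i < j → j < 5 → b i ≠ b j) (hc : ∀ i j, i < j → j < 5 → c i ≠ c j)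
    (hbc : ∀ i j, i < j → j < 5 → b i < b j → c j < c i) :
    finB (lk5 (b 0) (b 1) (b 2) (b 3) (b 4)) (lk5 (c 0) (c 1) (c 2) (c 3) (c 4)) = true := by
  have hB : ∀ i j, i < j → j < 5 → Nat.beq (b i) (b j) = false := fun i j h1 h2 =>
    beqF (hb i j h1 h2)
  have hC : ∀ i j, i < j → j < 5 → cmpat (b i) (c i) (b j) (c j) = true := fun i j h1 h2 =>
    cmpat_true (hc i j h1 h2) (hbc i j h1 h2) (hb i j h1 h2)
  have mb : ∀ i < 5, b i ∈ L5 := fun i hi => mem_L5.2 (hb5 i hi)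
  have mc : ∀ i < 5, c i ∈ L5 := fun i hi => mem_L5.2 (hc5 i hi)
  have H := srch_true
  unfold srch at H
  have H := List.all_eq_true.1 H (b 0) (mb 0 (by omega))
  have H := List.all_eq_true.1 H (b 1) (mb 1 (by omega))
  rw [hB 0 1 (by omega) (by omega), Bool.false_or] at H
  have H := List.all_eq_true.1 H (b 2) (mb 2 (by omega))
  rw [hB 0 2 (by omega) (by omega), hB 1 2 (by omega) (by omega), Bool.false_or,
    Bool.false_or] at H
  have H := List.all_eq_true.1 H (b 3) (mb 3 (by omega))
  rw [hB 0 3 (by omega) (by omega), hB 1 3 (by omega) (by omega), hB 2 3 (by omega) (by omega),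
    Bool.false_or, Bool.false_or, Bool.false_or] at H
  have H := List.all_eq_true.1 H (b 4) (mb 4 (by omega))
  rw [hB 0 4 (by omega) (by omega), hB 1 4 (by omega) (by omega), hB 2 4 (by omega) (by omega),
    hB 3 4 (by omega) (by omega), Bool.false_or, Bool.false_or, Bool.false_or, Bool.false_or] at H
  have H := List.all_eq_true.1 H (c 0) (mc 0 (by omega))
  have H := List.all_eq_true.1 H (c 1) (mc 1 (by omega))
  rw [hC 0 1 (by omega) (by omega), Bool.not_true, Bool.false_or] at H
  have H := List.all_eq_true.1 H (c 2) (mc 2 (by omega))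
  rw [hC 0 2 (by omega) (by omega), hC 1 2 (by omega) (by omega), Bool.true_and,
    Bool.not_true, Bool.false_or] at H
  have H := List.all_eq_true.1 H (c 3) (mc 3 (by omega))
  rw [hC 0 3 (by omega) (by omega), hC 1 3 (by omega) (by omega), hC 2 3 (by omega) (by omega),
    Bool.true_and, Bool.true_and, Bool.not_true, Bool.false_or] at H
  have H := List.all_eq_true.1 H (c 4) (mc 4 (by omega))
  rw [hC 0 4 (by omega) (by omega), hC 1 4 (by omega) (by omega), hC 2 4 (by omega) (by omega),
    hC 3 4 (by omega) (by omega),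
    Bool.true_and, Bool.true_and, Bool.true_and, Bool.not_true, Bool.false_or] at H
  exact H

/-- Rank function. -/
def rk (G : ℕ → ℝ) (n : ℕ) : ℕ := ((Finset.range 5).filter (fun k => G k < G n)).card

theorem rk_lt5 (G : ℕ → ℝ) {n : ℕ} (hn : n < 5) : rk G n < 5 := by
  have : (Finset.range 5).filter (fun k => G k < G n) ⊂ Finset.range 5 := by
    rw [Finset.filter_ssubset]
    exact ⟨n, Finset.mem_range.2 hn, lt_irrefl _⟩
  simpa [rk] using Finset.card_lt_card this

theorem rk_mono (G : ℕ → ℝ) {i j : ℕ} (hi : i < 5) (h : G i < G j) : rk G i < rk G j := by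
  apply Finset.card_lt_card
  rw [Finset.ssubset_iff_of_subset]
  · exact ⟨i, by simp [hi, h], by simp⟩
  · intro k hk
    simp only [Finset.mem_filter] at hk ⊢
    exact ⟨hk.1, hk.2.trans h⟩

theorem rk_iff (G : ℕ → ℝ) {i j : ℕ} (hi : i < 5) (hj : j < 5) : rk G i < rk G j ↔ G i < G j := by
  refine ⟨fun h => ?_, rk_mono G hi⟩
  by_contra hn
  rcases (not_lt.1 hn).eq_or_lt with h' | h'
  · unfold rk at h; rw [h'] at h; exact lt_irrefl _ h
  · exact lt_asymm h (rk_mono G hj h')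

theorem comb (F G H : ℕ → ℝ) (hF0 : ∀ i < 5, 0 < F i) (hG0 : ∀ i < 5, 0 < G i)
    (hH0 : ∀ i < 5, 0 < H i) (hprod : ∀ i < 5, F i * G i * H i = 1)
    (hF : ∀ i j, i < j → j < 5 → F i < F j)
    (hG : ∀ i j, i < j → j < 5 → G i ≠ G j) (hH : ∀ i j, i < j → j < 5 → H i ≠ H j) :
    ∃ p q r s, p < 5 ∧ q < 5 ∧ r < 5 ∧ s < 5 ∧
      (Pat F G H p q r s ∨ Pat G H F p q r s ∨ Pat H F G p q r s) := by
  have inj : ∀ K : ℕ → ℝ, (∀ i j, i < j → j < 5 → K i ≠ K j) →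
      ∀ i j, i < j → j < 5 → rk K i ≠ rk K j := by
    intro K hK i j h1 h2
    rcases lt_or_gt_of_ne (hK i j h1 h2) with h | h
    · exact (rk_mono K (h1.trans h2) h).ne
    · exact (rk_mono K h2 h).ne'
  have key := comb_nat (rk G) (rk H) (fun i hi => rk_lt5 G hi) (fun i hi => rk_lt5 H hi)
    (inj G hG) (inj H hH) (by
      intro i j h1 h2 h3
      have hi := h1.trans h2
      rw [rk_iff G hi h2] at h3
      apply rk_mono H h2
      by_contra h4
      have h5 := hF i j h1 h2
      have e1 := hprod i hi
      have e2 := hprod j h2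
      have a1 : F i * G i < F j * G j := mul_lt_mul'' h5 h3 (hF0 i hi).le (hG0 i hi).le
      have a2 : F i * G i * H i < F j * G j * H j :=
        mul_lt_mul a1 (not_lt.1 h4) (hH0 i hi) (mul_pos (hF0 j h2) (hG0 j h2)).le
      linarith)
  have idF : ∀ {i j}, i < 5 → j < 5 → i < j → F i < F j := fun _ hj h => hF _ _ h hj
  have tr : ∀ (K : ℕ → ℝ) {i j}, i < 5 → j < 5 →
      lk5 (rk K 0) (rk K 1) (rk K 2) (rk K 3) (rk K 4) i <
        lk5 (rk K 0) (rk K 1) (rk K 2) (rk K 3) (rk K 4) j → K i < K j := by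
    intro K i j hi hj h
    rw [lk5_eq _ hi, lk5_eq _ hj] at h
    exact (rk_iff K hi hj).1 h
  simp only [finB, Bool.or_eq_true] at key
  rcases key with key | key | key
  · obtain ⟨p, q, r, s, hp, hq, hr, hs, h1, h2, h3, h4, h5⟩ := patB_true key
    exact ⟨p, q, r, s, hp, hq, hr, hs, Or.inl ⟨idF hp hs h1, idF hs hr h2, tr H hs hr h3,
      tr H hr hq h4, tr G hq hp h5⟩⟩
  · obtain ⟨p, q, r, s, hp, hq, hr, hs, h1, h2, h3, h4, h5⟩ := patB_true key
    exact ⟨p, q, r, s, hp, hq, hr, hs, Or.inr (Or.inl ⟨tr G hp hs h1, tr G hs hr h2, idF hs hr h3,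
      idF hr hq h4, tr H hq hp h5⟩)⟩
  · obtain ⟨p, q, r, s, hp, hq, hr, hs, h1, h2, h3, h4, h5⟩ := patB_true key
    exact ⟨p, q, r, s, hp, hq, hr, hs, Or.inr (Or.inr ⟨tr H hp hs h1, tr H hs hr h2, tr G hs hr h3,
      tr G hr hq h4, idF hq hp h5⟩)⟩

/-! ### Angular keys -/

theorem key_lt (A B C x y : Pt) (hT : 0 < D A B C) (hx : Ins A B C x) (hy : Ins A B C y) :
    D A B x / D C A x < D A B y / D C A y ↔ 0 < D A x y := by
  have e := D_bary A B C x y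
  rw [div_lt_div_iff₀ hx.2.1 hy.2.1]
  constructor
  · intro h
    have : 0 < D A x y * D A B C := by rw [e]; linarith
    exact pos_of_mul_pos_left this hT.le
  · intro h
    have := mul_pos h hT
    rw [e] at this; linarith

theorem key_ne (A B C x y : Pt) (hx : Ins A B C x) (hy : Ins A B C y) (hT : 0 < D A B C)
    (h : D A x y ≠ 0) : D A B x / D C A x ≠ D A B y / D C A y := by
  intro h'
  rw [div_eq_div_iff hx.2.1.ne' hy.2.1.ne'] at h'
  have e := D_bary A B C x y
  have : D A x y * D A B C = 0 := by rw [e]; linarith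
  exact h ((mul_eq_zero.1 this).resolve_right hT.ne')

theorem collinear_of_D (p q r : Pt) (hpq : p ≠ q) (h : D p q r = 0) :
    Collinear ℝ ({p, q, r} : Set Pt) := by
  rw [collinear_iff_of_mem (p₀ := p) (by simp)]
  refine ⟨q - p, ?_⟩
  rw [D_eq] at h
  have : ∃ t : ℝ, r = t • (q - p) +ᵥ p := by
    by_cases h1 : q.1 - p.1 = 0
    · have h2 : q.2 - p.2 ≠ 0 := by
        intro h2
        exact hpq (Prod.ext (by linarith) (by linarith))
      have h3 : r.1 - p.1 = 0 := by
        rw [h1] at h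
        simp only [zero_mul, zero_sub, neg_eq_zero] at h
        exact (mul_eq_zero.1 h).resolve_left h2
      refine ⟨(r.2 - p.2) / (q.2 - p.2), Prod.ext ?_ ?_⟩
      · simp [h1]; linarith
      · simp [div_mul_cancel₀ _ h2]
    · refine ⟨(r.1 - p.1) / (q.1 - p.1), Prod.ext ?_ ?_⟩
      · simp [div_mul_cancel₀ _ h1]
      · simp only [vadd_eq_add, Prod.snd_add, Prod.smul_snd, Prod.snd_sub, smul_eq_mul]
        field_simp
        linarith
  intro x hx
  simp only [Set.mem_insert_iff, Set.mem_singleton_iff] at hx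
  rcases hx with rfl | rfl | rfl
  · exact ⟨0, by simp⟩
  · exact ⟨1, by simp⟩
  · exact this

theorem D_pos_of_interior (A B C : Pt) (hT : 0 < D A B C) (p : Pt)
    (hp : p ∈ interior (convexHull ℝ ({A, B, C} : Set Pt))) : 0 < D A B p := by
  have hsub : convexHull ℝ ({A, B, C} : Set Pt) ⊆ {x | 0 ≤ D A B x} := by
    apply convexHull_min
    · rintro x hx
      simp only [Set.mem_insert_iff, Set.mem_singleton_iff] at hx
      rcases hx with rfl | rfl | rfl
      · exact (D_self₂ _ _).ge
      · exact (D_self₃ _ _).ge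
      · exact hT.le
    · intro x hx y hy s t hs ht hst
      change 0 ≤ D A B _
      rw [D_comb _ _ _ _ _ _ hst]
      have h1 : 0 ≤ D A B x := hx
      have h2 : 0 ≤ D A B y := hy
      positivity
  by_contra hneg
  have h0 : D A B p ≤ 0 := not_lt.1 hneg
  have hcont : Continuous (fun e : ℝ => (1 + e) • p + (-e) • C) := by fun_prop
  have hn : interior (convexHull ℝ ({A, B, C} : Set Pt)) ∈
      nhds ((fun e : ℝ => (1 + e) • p + (-e) • C) 0) := by
    apply isOpen_interior.mem_nhds
    simpa using hp
  have hev := hcont.continuousAt.eventually_mem hn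
  have hev2 := (hev.filter_mono (nhdsWithin_le_nhds (s := Set.Ioi 0))).and self_mem_nhdsWithin
  obtain ⟨e, he1, he2⟩ := hev2.exists
  have he2 : 0 < e := he2
  have h3 : 0 ≤ D A B ((1 + e) • p + (-e) • C) := hsub (interior_subset he1)
  rw [D_comb _ _ _ _ _ _ (by ring)] at h3
  have h4 : 0 < e * D A B C := mul_pos he2 hT
  have h5 : (1 + e) * D A B p ≤ 0 := mul_nonpos_of_nonneg_of_nonpos (by linarith) h0
  linarith

theorem ins_of_interior (A B C : Pt) (hT : 0 < D A B C) (p : Pt)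
    (hp : p ∈ interior (convexHull ℝ ({A, B, C} : Set Pt))) : Ins A B C p := by
  refine ⟨D_pos_of_interior B C A (by rw [← D_rot]; exact hT) p ?_,
    D_pos_of_interior C A B (by rw [D_rot]; exact hT) p ?_, D_pos_of_interior A B C hT p hp⟩
  · convert hp using 3
    ext x; simp only [Set.mem_insert_iff, Set.mem_singleton_iff]; tauto
  · convert hp using 3
    ext x; simp only [Set.mem_insert_iff, Set.mem_singleton_iff]; tauto

theorem hull_eq (S : Set Pt) (hfin : S.Finite) :
    convexHull ℝ S ⊆ convexHull ℝ (hullVertices S) := by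
  have hE : (convexHull ℝ S).extremePoints ℝ ⊆ hullVertices S := by
    intro x hx
    refine ⟨extremePoints_convexHull_subset hx, fun hx' => ?_⟩
    rw [(convex_convexHull ℝ S).mem_extremePoints_iff_mem_diff_convexHull_diff] at hx
    exact hx.2 (convexHull_mono (Set.diff_subset_diff_left (subset_convexHull ℝ S)) hx')
  have hEf : (hullVertices S).Finite := hfin.subset (fun x hx => hx.1)
  have h := closure_convexHull_extremePoints (hfin.isCompact_convexHull ℝ) (convex_convexHull ℝ S)
  exact h.ge.trans (closure_minimal (convexHull_mono hE) (hEf.isClosed_convexHull ℝ))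

theorem range_vec {S : Set Pt} {A B C p q r s : Pt} (hA : A ∈ S) (hB : B ∈ S) (hC : C ∈ S)
    (hp : p ∈ S) (hq : q ∈ S) (hr : r ∈ S) (hs : s ∈ S) :
    Set.range (![A, p, B, q, C, r, s] : Fin 7 → Pt) ⊆ S := by
  rintro _ ⟨i, rfl⟩
  fin_cases i <;> assumption

theorem main_aux (S : Set Pt) (hfin : S.Finite) (hgp : GenPos S) (A B C : Pt)
    (hA : A ∈ S) (hB : B ∈ S) (hC : C ∈ S) (hT : 0 < D A B C)
    (hhull : convexHull ℝ S ⊆ convexHull ℝ ({A, B, C} : Set Pt))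
    (hint : 5 ≤ (interiorPts S).ncard) :
    ∃ v : ZMod 7 → Pt, Set.range v ⊆ S ∧ IsPseudoTriangle 7 v := by
  have hTB : 0 < D B C A := by rw [← D_rot]; exact hT
  have hTC : 0 < D C A B := by rw [D_rot]; exact hT
  have hins : ∀ p ∈ interiorPts S, Ins A B C p := fun p hp =>
    ins_of_interior A B C hT p (interior_mono hhull hp.2)
  have rot1 : ∀ x, Ins A B C x → Ins B C A x := fun x h => ⟨h.2.1, h.2.2, h.1⟩
  have rot2 : ∀ x, Ins A B C x → Ins C A B x := fun x h => ⟨h.2.2, h.1, h.2.1⟩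
  have hIf : (interiorPts S).Finite := hfin.subset (fun x hx => hx.1)
  obtain ⟨t, htI, htc⟩ := Set.exists_subset_card_eq hint
  have htf : t.Finite := hIf.subset htI
  have := htf.fintype
  have hc5 : Fintype.card t = 5 := by rw [← htc, Set.ncard_eq_toFinset_card', Set.toFinset_card]
  let e : Fin 5 ≃ t := (Fintype.equivFinOfCardEq hc5).symm
  let kA : Pt → ℝ := fun x => D A B x / D C A x
  let kB : Pt → ℝ := fun x => D B C x / D A B x
  let kC : Pt → ℝ := fun x => D C A x / D B C x
  let σ := Tuple.sort (fun i => kA (e i))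
  have hσ : Monotone ((fun i => kA (e i)) ∘ σ) := Tuple.monotone_sort _
  let P : ℕ → Pt := fun n => e (σ (Fin.ofNat 5 n))
  have hPI : ∀ n, P n ∈ interiorPts S := fun n => htI (e (σ (Fin.ofNat 5 n))).2
  have hPS : ∀ n, P n ∈ S := fun n => (hPI n).1
  have hP : ∀ n, Ins A B C (P n) := fun n => hins _ (hPI n)
  have hPne : ∀ i j, i < j → j < 5 → P i ≠ P j := by
    intro i j h1 h2 h
    have := σ.injective (e.injective (Subtype.ext h))
    have := congrArg Fin.val this
    simp only [Fin.ofNat] at this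
    rw [Nat.mod_eq_of_lt h2, Nat.mod_eq_of_lt (h1.trans h2)] at this
    omega
  have hD : ∀ V ∈ S, (∀ n, V ≠ P n) → ∀ i j, i < j → j < 5 → D V (P i) (P j) ≠ 0 := by
    intro V hV hVn i j h1 h2 h
    exact hgp V hV _ (hPS i) _ (hPS j) (hVn i) (hVn j) (hPne i j h1 h2)
      (collinear_of_D _ _ _ (hVn i) h)
  have nA : ∀ n, A ≠ P n := fun n h => by
    have := (hP n).2.2; rw [← h, D_self₂] at this; exact this.false
  have nB : ∀ n, B ≠ P n := fun n h => by
    have := (hP n).2.2; rw [← h, D_self₃] at this; exact this.false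
  have nC : ∀ n, C ≠ P n := fun n h => by
    have := (hP n).1; rw [← h, D_self₃] at this; exact this.false
  have neA : ∀ i j, i < j → j < 5 → kA (P i) ≠ kA (P j) := fun i j h1 h2 =>
    key_ne A B C _ _ (hP i) (hP j) hT (hD A hA nA i j h1 h2)
  have neB : ∀ i j, i < j → j < 5 → kB (P i) ≠ kB (P j) := fun i j h1 h2 =>
    key_ne B C A _ _ (rot1 _ (hP i)) (rot1 _ (hP j)) hTB (hD B hB nB i j h1 h2)
  have neC : ∀ i j, i < j → j < 5 → kC (P i) ≠ kC (P j) := fun i j h1 h2 =>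
    key_ne C A B _ _ (rot2 _ (hP i)) (rot2 _ (hP j)) hTC (hD C hC nC i j h1 h2)
  have ltA : ∀ {i j}, kA (P i) < kA (P j) → 0 < D A (P i) (P j) := fun {i j} h =>
    (key_lt A B C _ _ hT (hP i) (hP j)).1 h
  have ltB : ∀ {i j}, kB (P i) < kB (P j) → 0 < D B (P i) (P j) := fun {i j} h =>
    (key_lt B C A _ _ hTB (rot1 _ (hP i)) (rot1 _ (hP j))).1 h
  have ltC : ∀ {i j}, kC (P i) < kC (P j) → 0 < D C (P i) (P j) := fun {i j} h =>
    (key_lt C A B _ _ hTC (rot2 _ (hP i)) (rot2 _ (hP j))).1 h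
  obtain ⟨p, q, r, s, -, -, -, -, h⟩ := comb (fun n => kA (P n)) (fun n => kB (P n))
    (fun n => kC (P n))
    (fun i _ => div_pos (hP i).2.2 (hP i).2.1) (fun i _ => div_pos (hP i).1 (hP i).2.2)
    (fun i _ => div_pos (hP i).2.1 (hP i).1)
    (fun i _ => by
      have h1 := (hP i).1.ne'
      have h2 := (hP i).2.1.ne'
      have h3 := (hP i).2.2.ne'
      simp only [kA, kB, kC]
      field_simp)
    (fun i j h1 h2 => lt_of_le_of_ne (hσ (by
      rw [Fin.le_def]
      simp only [Fin.ofNat]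
      rw [Nat.mod_eq_of_lt h2, Nat.mod_eq_of_lt (h1.trans h2)]
      exact h1.le)) (neA i j h1 h2)) neB neC
  rcases h with ⟨h1, h2, h3, h4, h5⟩ | ⟨h1, h2, h3, h4, h5⟩ | ⟨h1, h2, h3, h4, h5⟩
  · exact ⟨_, range_vec hA hB hC (hPS p) (hPS q) (hPS r) (hPS s),
      template A B C (P p) (P q) (P r) (P s) hT (hP _) (hP _) (hP _) (hP _)
        (ltA h1) (ltA h2) (ltB h5) (ltC h4) (ltC h3)⟩
  · exact ⟨_, range_vec hB hC hA (hPS p) (hPS q) (hPS r) (hPS s),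
      template B C A (P p) (P q) (P r) (P s) hTB (rot1 _ (hP _)) (rot1 _ (hP _)) (rot1 _ (hP _))
        (rot1 _ (hP _)) (ltB h1) (ltB h2) (ltC h5) (ltA h4) (ltA h3)⟩
  · exact ⟨_, range_vec hC hA hB (hPS p) (hPS q) (hPS r) (hPS s),
      template C A B (P p) (P q) (P r) (P s) hTC (rot2 _ (hP _)) (rot2 _ (hP _)) (rot2 _ (hP _))
        (rot2 _ (hP _)) (ltC h1) (ltC h2) (ltA h5) (ltB h4) (ltB h3)⟩

/-- a set in general position with triangular convex hull and at least
5 interior points contains a 7-pseudo-triangle (not necessarily empty). -/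
theorem statement_4 (S : Set Pt) (hfin : S.Finite) (hgp : GenPos S)
    (hhull : (hullVertices S).ncard = 3) (hint : 5 ≤ (interiorPts S).ncard) :
    ∃ v : ZMod 7 → Pt, Set.range v ⊆ S ∧ IsPseudoTriangle 7 v := by
  obtain ⟨A, B, C, hAB, hAC, hBC, hE⟩ := Set.ncard_eq_three.1 hhull
  have hsub : ∀ x ∈ ({A, B, C} : Set Pt), x ∈ S := fun x hx => by
    rw [← hE] at hx; exact hx.1
  have hA : A ∈ S := hsub A (by simp)
  have hB : B ∈ S := hsub B (by simp)
  have hC : C ∈ S := hsub C (by simp)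
  have hh := hull_eq S hfin
  rw [hE] at hh
  have hne : D A B C ≠ 0 := fun h =>
    hgp A hA B hB C hC hAB hAC hBC (collinear_of_D A B C hAB h)
  rcases lt_or_gt_of_ne hne with h | h
  · refine main_aux S hfin hgp A C B hA hC hB (by rw [D_swap]; linarith) ?_ hint
    convert hh using 2
    ext x; simp only [Set.mem_insert_iff, Set.mem_singleton_iff]; tauto
  · exact main_aux S hfin hgp A B C hA hB hC h hh hint
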